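/- The series ∑_{k=1}^∞ (h_k/k²)·(∑_{i=1}^k h_i/i) converges and equals -(31/32)·ζ(5) + (45/8)·ln(2)·ζ(4) + (7/8)·ζ(2)·ζ(3). -/

import Mathlib

open Finset Real

noncomputable def H (k : ℕ) : ℝ := ∑ j ∈ Finset.range k, (1 : ℝ) / ((j : ℝ) + 1)
noncomputable def H2 (k : ℕ) : ℝ := ∑ j ∈ Finset.range k, (1 : ℝ) / ((j : ℝ) + 1) ^ 2
noncomputable def H3 (k : ℕ) : ℝ := ∑ j ∈ Finset.range k, (1 : ℝ) / ((j : ℝ) + 1) ^ 3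
noncomputable def h (k : ℕ) : ℝ := ∑ j ∈ Finset.range k, (1 : ℝ) / (2 * (j : ℝ) + 1)
noncomputable def h2 (k : ℕ) : ℝ := ∑ j ∈ Finset.range k, (1 : ℝ) / (2 * (j : ℝ) + 1) ^ 2
noncomputable def h3 (k : ℕ) : ℝ := ∑ j ∈ Finset.range k, (1 : ℝ) / (2 * (j : ℝ) + 1) ^ 3
noncomputable def zeta (s : ℕ) : ℝ := ∑' n : ℕ, (1 : ℝ) / ((n : ℝ) + 1) ^ s

/-- The sum of `1 / (j ^ p * N ^ q)` over `j = 2a + α` and `N = j + (2b + β)`. -/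
noncomputable def doubleSum (α β : ℝ) (p q : ℕ) : ℝ :=
  ∑' x : ℕ × ℕ, 1 / ((2 * (x.1 : ℝ) + α) ^ p * (2 * (x.1 : ℝ) + α + (2 * (x.2 : ℝ) + β)) ^ q)

/-- The sum of `1 / (2a + α) ^ s`. -/
noncomputable def stepSum (α : ℝ) (s : ℕ) : ℝ := ∑' a : ℕ, 1 / (2 * (a : ℝ) + α) ^ s

lemma stepSum_nonneg {α : ℝ} (hα : 0 ≤ α) (s : ℕ) : 0 ≤ stepSum α s :=
  tsum_nonneg fun a => by positivity

lemma doubleSum_nonneg {α β : ℝ} (hα : 0 ≤ α) (hβ : 0 ≤ β) (p q : ℕ) : 0 ≤ doubleSum α β p q :=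
  tsum_nonneg fun x => by positivity

lemma one_le_step {α : ℝ} (hα : 1 ≤ α) (a : ℕ) : 1 ≤ 2 * (a : ℝ) + α := by
  have := a.cast_nonneg (α := ℝ); linarith

lemma summable_one_div_succ_pow {s : ℕ} (hs : 2 ≤ s) :
    Summable fun a : ℕ => 1 / ((a : ℝ) + 1) ^ s := by
  have := (summable_nat_add_iff 1).2 (Real.summable_one_div_nat_pow.2 (by omega : 1 < s))
  simpa using this

lemma hasSum_stepSum {α : ℝ} (hα : 1 ≤ α) {s : ℕ} (hs : 2 ≤ s) :
    HasSum (fun a : ℕ => 1 / (2 * (a : ℝ) + α) ^ s) (stepSum α s) := by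
  refine Summable.hasSum (Summable.of_nonneg_of_le (fun a => ?_) (fun a => ?_)
    (summable_one_div_succ_pow hs))
  · have := one_le_step hα a; positivity
  · have := a.cast_nonneg (α := ℝ)
    gcongr
    linarith

lemma summable_stepSum_mul {α β : ℝ} (hα : 1 ≤ α) (hβ : 1 ≤ β) {s t : ℕ}
    (hs : 2 ≤ s) (ht : 2 ≤ t) :
    Summable fun x : ℕ × ℕ => 1 / (2 * (x.1 : ℝ) + α) ^ s * (1 / (2 * (x.2 : ℝ) + β) ^ t) := by
  refine Summable.mul_of_nonneg (hasSum_stepSum hα hs).summable (hasSum_stepSum hβ ht).summable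
    (fun a => ?_) (fun b => ?_)
  · have := one_le_step hα a; simp only [Pi.zero_apply]; positivity
  · have := one_le_step hβ b; simp only [Pi.zero_apply]; positivity

lemma hasSum_stepSum_mul {α β : ℝ} (hα : 1 ≤ α) (hβ : 1 ≤ β) {s t : ℕ}
    (hs : 2 ≤ s) (ht : 2 ≤ t) :
    HasSum (fun x : ℕ × ℕ => 1 / (2 * (x.1 : ℝ) + α) ^ s * (1 / (2 * (x.2 : ℝ) + β) ^ t))
      (stepSum α s * stepSum β t) :=
  (hasSum_stepSum hα hs).mul (hasSum_stepSum hβ ht) (summable_stepSum_mul hα hβ hs ht)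

lemma sq_mul_sq_le {j m : ℝ} (hj : 1 ≤ j) (hm : 1 ≤ m) {p q : ℕ} (hp : 1 ≤ p) (hq : 2 ≤ q)
    (hpq : 4 ≤ p + q) : j ^ 2 * m ^ 2 ≤ j ^ p * (j + m) ^ q := by
  rcases Nat.lt_or_ge p 2 with h | h
  · obtain rfl : p = 1 := by omega
    have h3 : (j + m) ^ 3 ≤ (j + m) ^ q := pow_le_pow_right₀ (by linarith) (by omega)
    have h2 : j * m ^ 2 ≤ (j + m) * (j + m) ^ 2 := by gcongr <;> linarith
    nlinarith
  · have h1 : j ^ 2 ≤ j ^ p := pow_le_pow_right₀ hj h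
    have h2 : m ^ 2 ≤ (j + m) ^ q :=
      (pow_le_pow_left₀ (by linarith) (by linarith) 2).trans
        (pow_le_pow_right₀ (by linarith : 1 ≤ j + m) hq)
    gcongr

lemma hasSum_doubleSum {α β : ℝ} (hα : 1 ≤ α) (hβ : 1 ≤ β) {p q : ℕ} (hp : 1 ≤ p) (hq : 2 ≤ q)
    (hpq : 4 ≤ p + q) :
    HasSum (fun x : ℕ × ℕ =>
      1 / ((2 * (x.1 : ℝ) + α) ^ p * (2 * (x.1 : ℝ) + α + (2 * (x.2 : ℝ) + β)) ^ q))
      (doubleSum α β p q) := by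
  refine Summable.hasSum (Summable.of_nonneg_of_le (fun x => ?_) (fun x => ?_)
    (summable_stepSum_mul hα hβ le_rfl le_rfl))
  all_goals
    have h1 := one_le_step hα x.1
    have h2 := one_le_step hβ x.2
  · positivity
  · rw [div_mul_div_comm, one_mul]
    exact one_div_le_one_div_of_le (by positivity) (sq_mul_sq_le h1 h2 hp hq hpq)

/-- Splitting the quadrant into the pairs on or above the diagonal and those below it. -/
def quadrantEquiv : (ℕ × ℕ) ⊕ (ℕ × ℕ) ≃ ℕ × ℕ where
  toFun := Sum.elim (fun x => (x.1, x.1 + x.2)) (fun x => (x.1 + 1 + x.2, x.1))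
  invFun y := if y.1 ≤ y.2 then .inl (y.1, y.2 - y.1) else .inr (y.2, y.1 - y.2 - 1)
  left_inv := by
    rintro (⟨a, c⟩ | ⟨a, c⟩)
    · simp
    · have : ¬ a + 1 + c ≤ a := by omega
      simp [this]; omega
  right_inv := by
    rintro ⟨a, b⟩
    by_cases hab : a ≤ b
    · simp [hab]
    · simp [hab]; omega

/-- Splitting off the first column of the quadrant. -/
def columnEquiv : ℕ ⊕ (ℕ × ℕ) ≃ ℕ × ℕ where
  toFun := Sum.elim (fun a => (a, 0)) (fun x => (x.1, x.2 + 1))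
  invFun y := if y.2 = 0 then .inl y.1 else .inr (y.1, y.2 - 1)
  left_inv := by rintro (a | ⟨a, c⟩) <;> simp
  right_inv := by
    rintro ⟨a, b⟩
    by_cases hb : b = 0
    · simp [hb]
    · simp [hb]; omega

lemma hasSum_quadrant {f : ℕ × ℕ → ℝ} {s t : ℝ}
    (hs : HasSum (fun x : ℕ × ℕ => f (x.1, x.1 + x.2)) s)
    (ht : HasSum (fun x : ℕ × ℕ => f (x.1 + 1 + x.2, x.1)) t) : HasSum f (s + t) :=
  quadrantEquiv.hasSum_iff.1 (HasSum.sum (f := f ∘ quadrantEquiv) hs ht)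

lemma hasSum_column {f : ℕ × ℕ → ℝ} {s t : ℝ}
    (hs : HasSum (fun a : ℕ => f (a, 0)) s)
    (ht : HasSum (fun x : ℕ × ℕ => f (x.1, x.2 + 1)) t) : HasSum f (s + t) :=
  columnEquiv.hasSum_iff.1 (HasSum.sum (f := f ∘ columnEquiv) hs ht)

/-- The quasi-shuffle product for two arguments of the same parity. -/
lemma stuffle_odd_odd :
    doubleSum 1 2 3 2 + doubleSum 1 2 2 3 + stepSum 1 5 = stepSum 1 2 * stepSum 1 3 := by
  refine HasSum.unique ?_ (hasSum_stepSum_mul le_rfl le_rfl le_rfl (by norm_num : 2 ≤ 3))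
  rw [add_comm (_ + _), add_comm (doubleSum 1 2 3 2), ← add_assoc]
  refine hasSum_quadrant (hasSum_column ?_ ?_) ?_
  · convert hasSum_stepSum le_rfl (by norm_num : 2 ≤ 5) using 2 with a
    have := one_le_step le_rfl a
    push_cast; simp; field_simp
  · convert hasSum_doubleSum le_rfl one_le_two (by norm_num : 1 ≤ 2) (by norm_num : 2 ≤ 3)
      (by norm_num) using 2 with x
    push_cast
    rw [div_mul_div_comm]; congr 2 <;> ring
  · convert hasSum_doubleSum le_rfl one_le_two (by norm_num : 1 ≤ 3) (by norm_num : 2 ≤ 2)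
      (by norm_num) using 2 with x
    push_cast
    rw [div_mul_div_comm, one_mul, mul_comm ((2 * ((x.1 : ℝ) + 1 + x.2) + 1) ^ 2)]
    congr 2
    ring

/-- The quasi-shuffle product for two arguments of different parity. -/
lemma stuffle_odd_even {p q : ℕ} (hp : 2 ≤ p) (hq : 2 ≤ q) :
    doubleSum 1 1 p q + doubleSum 2 1 q p = stepSum 1 p * stepSum 2 q := by
  refine HasSum.unique ?_ (hasSum_stepSum_mul le_rfl one_le_two hp hq)
  refine hasSum_quadrant ?_ ?_
  · convert hasSum_doubleSum (α := 1) (β := 1) le_rfl le_rfl (by omega : 1 ≤ p) hq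
      (by omega) using 2 with x
    push_cast
    rw [div_mul_div_comm]; congr 2 <;> ring
  · convert hasSum_doubleSum (α := 2) (β := 1) one_le_two le_rfl (by omega : 1 ≤ q) hp
      (by omega) using 2 with x
    push_cast
    rw [div_mul_div_comm, one_mul, mul_comm ((2 * ((x.1 : ℝ) + 1 + x.2) + 1) ^ p)]
    congr 2; ring

/-- The shuffle product, from the partial fraction expansion of `1 / (j ^ 2 * m ^ 3)`. -/
lemma shuffle_two_three {α β : ℝ} (hα : 1 ≤ α) (hβ : 1 ≤ β) :
    doubleSum α β 2 3 + 3 * doubleSum α β 1 4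
      + (doubleSum β α 3 2 + 2 * doubleSum β α 2 3 + 3 * doubleSum β α 1 4)
      = stepSum α 2 * stepSum β 3 := by
  refine HasSum.unique ?_ (hasSum_stepSum_mul hα hβ le_rfl (by norm_num : 2 ≤ 3))
  have key {p q : ℕ} (hp : 1 ≤ p) (hq : 2 ≤ q) (hpq : 4 ≤ p + q) :=
    (Equiv.prodComm ℕ ℕ).hasSum_iff.2 (hasSum_doubleSum hβ hα hp hq hpq)
  convert! ((hasSum_doubleSum hα hβ (by norm_num : 1 ≤ 2) (by norm_num : 2 ≤ 3) (by norm_num)).add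
    ((hasSum_doubleSum hα hβ (by norm_num : 1 ≤ 1) (by norm_num : 2 ≤ 4)
      (by norm_num)).mul_left 3)).add (((key (by norm_num : 1 ≤ 3) le_rfl (by norm_num)).add
    ((key (by norm_num : 1 ≤ 2) (by norm_num : 2 ≤ 3) (by norm_num)).mul_left 2)).add
    ((key le_rfl (by norm_num : 2 ≤ 4) (by norm_num)).mul_left 3)) using 2 with x
  have h1 := one_le_step hα x.1
  have h2 := one_le_step hβ x.2
  simp only [Function.comp, Equiv.prodComm_apply, Prod.fst_swap, Prod.snd_swap]
  generalize 2 * (x.1 : ℝ) + α = j at *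
  generalize 2 * (x.2 : ℝ) + β = m at *
  have : 0 < j + m := by linarith
  rw [add_comm m j]
  field_simp
  ring

lemma hasSum_telescope_step {α : ℝ} (hα : 1 ≤ α) :
    HasSum (fun a : ℕ => 1 / (2 * (a : ℝ) + α) - 1 / (2 * (a : ℝ) + α + 2)) (1 / α) := by
  have h0 : Filter.Tendsto (fun n : ℕ => 1 / (2 * (n : ℝ) + α)) Filter.atTop (nhds 0) := by
    simp only [one_div]
    exact tendsto_inv_atTop_zero.comp (Filter.tendsto_atTop_add_const_right _ _
      (tendsto_natCast_atTop_atTop.const_mul_atTop two_pos))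
  rw [hasSum_iff_tendsto_nat_of_nonneg]
  · have : ∀ n : ℕ, ∑ a ∈ Finset.range n,
        (1 / (2 * (a : ℝ) + α) - 1 / (2 * (a : ℝ) + α + 2)) = 1 / α - 1 / (2 * (n : ℝ) + α) := by
      intro n
      induction n with
      | zero => simp
      | succ n ih => rw [Finset.sum_range_succ, ih]; push_cast; ring
    simp only [this]
    simpa using h0.const_sub (1 / α)
  · intro a
    have := one_le_step hα a
    exact sub_nonneg.2 (one_div_le_one_div_of_le (by linarith) (by linarith))

lemma hasSum_log_two :
    HasSum (fun a : ℕ => 1 / (2 * (a : ℝ) + 1) - 1 / (2 * (a : ℝ) + 2)) (Real.log 2) := by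
  rw [hasSum_iff_tendsto_nat_of_nonneg]
  · have hsum : ∀ n : ℕ, ∑ a ∈ Finset.range n, (1 / (2 * (a : ℝ) + 1) - 1 / (2 * (a : ℝ) + 2))
        = harmonic (2 * n) - harmonic n := by
      intro n
      induction n with
      | zero => simp
      | succ n ih =>
        rw [Finset.sum_range_succ, ih, Nat.mul_succ, harmonic_succ, harmonic_succ, harmonic_succ]
        push_cast
        field_simp
        ring
    have h1 := Real.tendsto_harmonic_sub_log
    have h2 := (h1.comp (Filter.tendsto_id.const_mul_atTop' two_pos)).sub h1
    have h3 := h2.add_const (Real.log 2)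
    rw [sub_self, zero_add] at h3
    refine h3.congr' ?_
    filter_upwards [Filter.eventually_gt_atTop 0] with n hn
    rw [hsum]
    simp only [Function.comp, id]
    push_cast
    rw [Real.log_mul two_ne_zero (by positivity)]
    ring
  · intro a
    exact sub_nonneg.2 (one_div_le_one_div_of_le (by positivity) (by linarith))

/-- Shifting the second argument of a difference of reciprocals by steps of two. -/
lemma hasSum_sub_shift {α γ s : ℝ} (hγ : 1 ≤ γ)
    (hs : HasSum (fun a : ℕ => 1 / (2 * (a : ℝ) + α) - 1 / (2 * (a : ℝ) + γ)) s) (b : ℕ) :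
    HasSum (fun a : ℕ => 1 / (2 * (a : ℝ) + α) - 1 / (2 * (a : ℝ) + γ + 2 * b))
      (s + ∑ i ∈ Finset.range b, 1 / (2 * (i : ℝ) + γ)) := by
  induction b with
  | zero => simpa using hs
  | succ b ih =>
    have h1 := hasSum_telescope_step (one_le_step hγ b)
    rw [Finset.sum_range_succ, ← add_assoc]
    convert! ih.add h1 using 2 with a
    push_cast
    ring

/-- The sum over the triangle `i < b`, by rows. -/
lemma hasSum_triangle {F : ℕ → ℕ → ℝ} {t : ℝ}
    (ht : HasSum (fun x : ℕ × ℕ => F x.1 (x.1 + 1 + x.2)) t) :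
    HasSum (fun b : ℕ => ∑ i ∈ Finset.range b, F i b) t := by
  have h1 : HasSum (fun y : ℕ × ℕ => if y.2 < y.1 then F y.2 y.1 else 0) (0 + t) := by
    refine hasSum_quadrant ?_ ?_
    · simp [hasSum_zero]
    · convert ht using 2 with x
      simp [show x.1 < x.1 + 1 + x.2 by omega]
  rw [zero_add] at h1
  refine h1.prod_fiberwise fun b => ?_
  rw [Finset.sum_congr rfl fun i hi => (if_pos (Finset.mem_range.1 hi)).symm]
  exact hasSum_sum_of_ne_finset_zero fun i hi => if_neg (by simpa using hi)

lemma hasSum_mixed {α β : ℝ} (hα : 1 ≤ α) (hβ : 1 ≤ β) :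
    HasSum (fun x : ℕ × ℕ => 1 / (2 * (x.1 : ℝ) + β) ^ 4
      * (1 / (2 * (x.2 : ℝ) + α) - 1 / (2 * (x.2 : ℝ) + α + (2 * (x.1 : ℝ) + β))))
    (doubleSum α β 1 4 + doubleSum β α 1 4 + doubleSum β α 2 3 + doubleSum β α 3 2) := by
  have key := (Equiv.prodComm ℕ ℕ).hasSum_iff.2
    (hasSum_doubleSum hα hβ le_rfl (by norm_num : 2 ≤ 4) (by norm_num))
  convert! ((key.add
    (hasSum_doubleSum hβ hα le_rfl (by norm_num : 2 ≤ 4) (by norm_num))).add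
    (hasSum_doubleSum hβ hα (by norm_num : 1 ≤ 2) (by norm_num : 2 ≤ 3) (by norm_num))).add
    (hasSum_doubleSum hβ hα (by norm_num : 1 ≤ 3) le_rfl (by norm_num)) using 2 with x
  have h1 := one_le_step hβ x.1
  have h2 := one_le_step hα x.2
  simp only [Function.comp, Equiv.prodComm_apply, Prod.fst_swap, Prod.snd_swap]
  generalize 2 * (x.1 : ℝ) + β = m at *
  generalize 2 * (x.2 : ℝ) + α = j at *
  have : 0 < j + m := by linarith
  rw [add_comm m j]
  field_simp
  ring

lemma regularized_odd_odd :
    doubleSum 1 1 1 4 + doubleSum 1 1 1 4 + doubleSum 1 1 2 3 + doubleSum 1 1 3 2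
      = Real.log 2 * stepSum 1 4 + doubleSum 2 1 1 4 := by
  have h1 := (hasSum_mixed le_rfl le_rfl).prod_fiberwise (g := fun b : ℕ =>
    1 / (2 * (b : ℝ) + 1) ^ 4 * (Real.log 2 + ∑ i ∈ Finset.range b, 1 / (2 * (i : ℝ) + 2)))
    fun b => by
      convert! (hasSum_sub_shift one_le_two hasSum_log_two b).mul_left
        (1 / (2 * (b : ℝ) + 1) ^ 4) using 5
      ring
  refine h1.unique ?_
  convert! ((hasSum_stepSum le_rfl (by norm_num : 2 ≤ 4)).mul_left (Real.log 2)).add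
    (hasSum_triangle (F := fun i b => 1 / (2 * (b : ℝ) + 1) ^ 4 * (1 / (2 * (i : ℝ) + 2)))
      (t := doubleSum 2 1 1 4) ?_) using 2 with b
  · rw [← Finset.mul_sum]; ring
  · convert hasSum_doubleSum one_le_two le_rfl le_rfl (by norm_num : 2 ≤ 4)
      (by norm_num) using 2 with x
    push_cast
    rw [div_mul_div_comm, one_mul, mul_comm ((2 * ((x.1 : ℝ) + 1 + x.2) + 1) ^ 4)]
    congr 2 <;> ring

lemma regularized_even_odd :
    doubleSum 2 1 1 4 + doubleSum 1 2 1 4 + doubleSum 1 2 2 3 + doubleSum 1 2 3 2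
      = -Real.log 2 * stepSum 1 4 + (stepSum 1 5 + doubleSum 1 2 1 4) := by
  have h1 := (hasSum_mixed one_le_two le_rfl).prod_fiberwise (g := fun b : ℕ =>
    1 / (2 * (b : ℝ) + 1) ^ 4
      * (-Real.log 2 + ∑ i ∈ Finset.range (b + 1), 1 / (2 * (i : ℝ) + 1)))
    fun b => by
      convert! (hasSum_sub_shift le_rfl (by simpa using hasSum_log_two.neg) (b + 1)).mul_left
        (1 / (2 * (b : ℝ) + 1) ^ 4) using 5
      push_cast
      ring
  refine h1.unique ?_
  convert! ((hasSum_stepSum le_rfl (by norm_num : 2 ≤ 4)).mul_left (-Real.log 2)).add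
    ((hasSum_stepSum le_rfl (by norm_num : 2 ≤ 5)).add
    (hasSum_triangle (F := fun i b => 1 / (2 * (b : ℝ) + 1) ^ 4 * (1 / (2 * (i : ℝ) + 1)))
      (t := doubleSum 1 2 1 4) ?_)) using 2 with b
  · rw [← Finset.mul_sum, Finset.sum_range_succ]
    have := one_le_step le_rfl b
    field_simp
    ring
  · convert hasSum_doubleSum le_rfl one_le_two le_rfl (by norm_num : 2 ≤ 4)
      (by norm_num) using 2 with x
    push_cast
    rw [div_mul_div_comm, one_mul, mul_comm ((2 * ((x.1 : ℝ) + 1 + x.2) + 1) ^ 4)]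
    congr 2 <;> ring

lemma stepSum_two {s : ℕ} : stepSum 2 s = (1 / 2 ^ s) * zeta s := by
  rw [stepSum, zeta, ← tsum_mul_left]
  refine tsum_congr fun a => ?_
  rw [div_mul_div_comm, one_mul, ← mul_pow]
  congr 2
  ring

lemma stepSum_one {s : ℕ} (hs : 2 ≤ s) : stepSum 1 s = (1 - 1 / 2 ^ s) * zeta s := by
  have h1 : HasSum (fun n : ℕ => 1 / ((n : ℝ) + 1) ^ s) (stepSum 1 s + stepSum 2 s) := by
    refine HasSum.even_add_odd ?_ ?_
    · simpa using hasSum_stepSum le_rfl hs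
    · convert hasSum_stepSum one_le_two hs using 3 with a
      push_cast; ring
  have h2 : zeta s = stepSum 1 s + stepSum 2 s := h1.tsum_eq
  rw [stepSum_two] at h2
  linarith

lemma doubleSum_evaluation :
    4 * stepSum 1 5 + 6 * (doubleSum 1 1 1 4 + doubleSum 1 2 1 4)
      + 2 * (doubleSum 1 1 2 3 + doubleSum 1 2 2 3)
      = -(31 / 32) * zeta 5 + (45 / 8) * Real.log 2 * zeta 4 + (7 / 8) * zeta 2 * zeta 3 := by
  have a1 := stuffle_odd_odd
  have a2 := stuffle_odd_even le_rfl (by norm_num : 2 ≤ 3)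
  have a3 := stuffle_odd_even (by norm_num : 2 ≤ 3) le_rfl
  have a4 := shuffle_two_three le_rfl one_le_two
  have a5 := shuffle_two_three one_le_two le_rfl
  have a6 := regularized_odd_odd
  have a7 := regularized_even_odd
  have o5 := stepSum_one (by norm_num : 2 ≤ 5)
  simp only [stepSum_one (le_refl 2), stepSum_one (by norm_num : 2 ≤ 3),
    stepSum_one (by norm_num : 2 ≤ 4), stepSum_two] at a1 a2 a3 a4 a5 a6 a7
  linear_combination 2 * a1 + 3 * a6 + a4 - a2 + a5 - 3 * a3 - 3 * a7 - o5

lemma tsum_ofReal_of_hasSum {ι : Type*} {f : ι → ℝ} {s : ℝ} (hf : ∀ i, 0 ≤ f i)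
    (hs : HasSum f s) : ∑' i, ENNReal.ofReal (f i) = ENNReal.ofReal s := by
  rw [← hs.tsum_eq, ENNReal.ofReal_tsum_of_nonneg hf hs.summable]

open MeasureTheory in
lemma lintegral_Ioo_of_hasDerivAt {F f : ℝ → ℝ} {a b : ℝ} (hab : a ≤ b)
    (hF : ContinuousOn F (Set.Icc a b)) (hd : ∀ x ∈ Set.Ioo a b, HasDerivAt F (f x) x)
    (hf : ∀ x ∈ Set.Ioo a b, 0 ≤ f x) :
    ∫⁻ x in Set.Ioo a b, ENNReal.ofReal (f x) = ENNReal.ofReal (F b - F a) := by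
  have hi := intervalIntegral.integrableOn_deriv_of_nonneg hF hd hf
  have h1 := intervalIntegral.integral_eq_sub_of_hasDerivAt_of_le hab hF hd
    ((intervalIntegrable_iff_integrableOn_Ioc_of_le hab).2 hi)
  rw [intervalIntegral.integral_of_le hab, integral_Ioc_eq_integral_Ioo] at h1
  rw [← h1, ofReal_integral_eq_lintegral_ofReal (hi.mono_set Set.Ioo_subset_Ioc_self)]
  exact (ae_restrict_iff' measurableSet_Ioo).2 (Filter.Eventually.of_forall hf)

open MeasureTheory in
lemma lintegral_Ioo_swap {f g : ℝ → ENNReal} (hf : Measurable f) (hg : Measurable g) :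
    ∫⁻ t in Set.Ioo (0 : ℝ) 1, f t * ∫⁻ u in Set.Ioo t 1, g u
      = ∫⁻ u in Set.Ioo (0 : ℝ) 1, g u * ∫⁻ t in Set.Ioo 0 u, f t := by
  have hS : MeasurableSet {x : ℝ × ℝ | 0 < x.1 ∧ x.1 < x.2 ∧ x.2 < 1} :=
    (measurableSet_lt measurable_const measurable_fst).inter
      ((measurableSet_lt measurable_fst measurable_snd).inter
        (measurableSet_lt measurable_snd measurable_const))
  have key := lintegral_lintegral_swap (μ := volume) (ν := volume)
    (f := fun t u => Set.indicator {x : ℝ × ℝ | 0 < x.1 ∧ x.1 < x.2 ∧ x.2 < 1}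
      (fun x => f x.1 * g x.2) (t, u))
    (((hf.comp measurable_fst).mul (hg.comp measurable_snd)).indicator hS).aemeasurable
  convert key using 1
  · rw [← lintegral_indicator measurableSet_Ioo]
    refine lintegral_congr fun t => ?_
    by_cases ht : t ∈ Set.Ioo (0 : ℝ) 1
    · rw [Set.indicator_of_mem ht, ← lintegral_indicator measurableSet_Ioo,
        ← lintegral_const_mul _ (hg.indicator measurableSet_Ioo)]
      refine lintegral_congr fun u => ?_
      by_cases hu : u ∈ Set.Ioo t 1
      · rw [Set.indicator_of_mem hu, Set.indicator_of_mem (by exact ⟨ht.1, hu.1, hu.2⟩)]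
      · rw [Set.indicator_of_notMem hu, mul_zero,
          Set.indicator_of_notMem (by exact fun h' => hu ⟨h'.2.1, h'.2.2⟩)]
    · rw [Set.indicator_of_notMem ht]
      refine (lintegral_eq_zero_of_ae_eq_zero (Filter.Eventually.of_forall fun u => ?_)).symm
      exact Set.indicator_of_notMem (by exact fun h' => ht ⟨h'.1, h'.2.1.trans h'.2.2⟩) _
  · rw [← lintegral_indicator measurableSet_Ioo]
    refine lintegral_congr fun u => ?_
    by_cases hu : u ∈ Set.Ioo (0 : ℝ) 1
    · rw [Set.indicator_of_mem hu, ← lintegral_indicator measurableSet_Ioo,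
        ← lintegral_const_mul _ (hf.indicator measurableSet_Ioo)]
      refine lintegral_congr fun t => ?_
      by_cases ht : t ∈ Set.Ioo 0 u
      · rw [Set.indicator_of_mem ht, Set.indicator_of_mem (by exact ⟨ht.1, ht.2, hu.2⟩), mul_comm]
      · rw [Set.indicator_of_notMem ht, mul_zero,
          Set.indicator_of_notMem (by exact fun h' => ht ⟨h'.1, h'.2.1⟩)]
    · rw [Set.indicator_of_notMem hu]
      refine (lintegral_eq_zero_of_ae_eq_zero (Filter.Eventually.of_forall fun t => ?_)).symm
      exact Set.indicator_of_notMem (by exact fun h' => hu ⟨h'.1.trans h'.2.1, h'.2.2⟩) _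

lemma continuousOn_mul_log_pow {p : ℕ} (hp : p ≠ 0) :
    ContinuousOn (fun u : ℝ => u * Real.log u ^ p) (Set.Ici 0) := by
  have hp' : (p : ℝ) ≠ 0 := by exact_mod_cast hp
  have h1 : Continuous fun u : ℝ =>
      (p : ℝ) ^ p * (u ^ (1 / (p : ℝ)) * Real.log (u ^ (1 / (p : ℝ)))) ^ p :=
    continuous_const.mul ((Real.continuous_mul_log.comp
      (Real.continuous_rpow_const (by positivity))).pow p)
  refine h1.continuousOn.congr fun u hu => ?_
  rcases (Set.mem_Ici.1 hu).eq_or_lt with rfl | hu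
  · simp [hp, hp']
  · have h2 : (u ^ (1 / (p : ℝ))) ^ p = u := by
      rw [← Real.rpow_natCast, ← Real.rpow_mul hu.le, one_div_mul_cancel hp', Real.rpow_one]
    simp only [Real.log_rpow hu, mul_pow, h2]
    rw [div_pow, one_pow]
    field_simp

lemma lintegral_pow_mul_neg_log {u : ℝ} (hu : 0 < u) (hu1 : u < 1) (n : ℕ) :
    ∫⁻ t in Set.Ioo 0 u, ENNReal.ofReal (t ^ n * -Real.log t)
      = ENNReal.ofReal (u ^ (n + 1) * (-Real.log u / (n + 1) + 1 / (n + 1) ^ 2)) := by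
  rw [lintegral_Ioo_of_hasDerivAt
    (F := fun t => t ^ (n + 1) * (-Real.log t / (n + 1) + 1 / (n + 1) ^ 2)) hu.le]
  · simp
  · have h1 : Continuous fun t : ℝ =>
        -(t ^ n * (t * Real.log t) / (n + 1)) + t ^ (n + 1) / (n + 1) ^ 2 :=
      (((continuous_pow n).mul Real.continuous_mul_log).div_const _).neg.add
        ((continuous_pow _).div_const _)
    refine h1.continuousOn.congr fun t _ => ?_
    ring
  · intro t ht
    have h0 := ht.1.ne'
    have h1 := (hasDerivAt_pow (n + 1) t).mul
      (((Real.hasDerivAt_log h0).neg.div_const ((n : ℝ) + 1)).add_const (1 / ((n : ℝ) + 1) ^ 2))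
    convert! h1 using 1
    simp only [Pi.neg_apply]
    push_cast
    field_simp
    ring
  · intro t ht
    have := Real.log_nonpos ht.1.le (ht.2.trans hu1).le
    exact mul_nonneg (pow_nonneg ht.1.le _) (by linarith)

lemma lintegral_pow_mul_log_cube_add_sq {j : ℝ} (hj : 0 < j) (n : ℕ) :
    ∫⁻ u in Set.Ioo (0 : ℝ) 1,
        ENNReal.ofReal (u ^ n * ((-Real.log u) ^ 3 / j + (-Real.log u) ^ 2 / j ^ 2))
      = ENNReal.ofReal (6 * (1 / (j ^ 1 * (n + 1) ^ 4)) + 2 * (1 / (j ^ 2 * (n + 1) ^ 3))) := by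
  have hN : (n : ℝ) + 1 ≠ 0 := by positivity
  rw [lintegral_Ioo_of_hasDerivAt (F := fun u => u ^ (n + 1) *
    ((-Real.log u ^ 3 / (n + 1) + 3 * Real.log u ^ 2 / (n + 1) ^ 2 - 6 * Real.log u / (n + 1) ^ 3
      + 6 / (n + 1) ^ 4) / j
      + (Real.log u ^ 2 / (n + 1) - 2 * Real.log u / (n + 1) ^ 2 + 2 / (n + 1) ^ 3) / j ^ 2))
    zero_le_one]
  · simp
    congr 1
    field_simp
  · have c3 := (continuousOn_mul_log_pow three_ne_zero).mono (Set.Icc_subset_Ici_self (b := (0 : ℝ)) (a := 1))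
    have c2 := (continuousOn_mul_log_pow two_ne_zero).mono (Set.Icc_subset_Ici_self (b := (0 : ℝ)) (a := 1))
    have c1 := (continuousOn_mul_log_pow one_ne_zero).mono (Set.Icc_subset_Ici_self (b := (0 : ℝ)) (a := 1))
    have h1 : ContinuousOn (fun u : ℝ => u ^ n *
        ((-(u * Real.log u ^ 3) / (n + 1) + 3 * (u * Real.log u ^ 2) / (n + 1) ^ 2
          - 6 * (u * Real.log u ^ 1) / (n + 1) ^ 3 + u * (6 / (n + 1) ^ 4)) / j
        + (u * Real.log u ^ 2 / (n + 1) - 2 * (u * Real.log u ^ 1) / (n + 1) ^ 2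
          + u * (2 / (n + 1) ^ 3)) / j ^ 2)) (Set.Icc 0 1) := by
      fun_prop (disch := positivity)
    refine h1.congr fun t _ => ?_
    ring
  · intro t ht
    have h0 := ht.1.ne'
    have hl := Real.hasDerivAt_log h0
    have h1 := (hasDerivAt_pow (n + 1) t).mul
      (((((((hl.pow 3).neg.div_const ((n : ℝ) + 1)).add
        (((hl.pow 2).const_mul 3).div_const (((n : ℝ) + 1) ^ 2))).sub
        ((hl.const_mul 6).div_const (((n : ℝ) + 1) ^ 3))).add_const
        (6 / ((n : ℝ) + 1) ^ 4)).div_const j).add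
      (((((hl.pow 2).div_const ((n : ℝ) + 1)).sub
        ((hl.const_mul 2).div_const (((n : ℝ) + 1) ^ 2))).add_const
        (2 / ((n : ℝ) + 1) ^ 3)).div_const (j ^ 2)))
    convert! h1 using 1
    simp only [Pi.add_apply, Pi.sub_apply, Pi.neg_apply, Pi.pow_apply]
    push_cast
    field_simp
    ring
  · intro t ht
    have := Real.log_nonpos ht.1.le ht.2.le
    have h1 : 0 ≤ -Real.log t := by linarith
    have h2 := ht.1
    positivity

/-- The involution exchanging `0` and `1` under which `artanh` becomes `-log / 2`. -/
noncomputable def cayley (t : ℝ) : ℝ := (1 - t) / (1 + t)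

lemma hasDerivAt_cayley {t : ℝ} (ht : 0 < 1 + t) : HasDerivAt cayley (-2 / (1 + t) ^ 2) t := by
  have h1 := ((hasDerivAt_id t).const_sub 1).div ((hasDerivAt_id t).const_add 1) ht.ne'
  convert! h1 using 1
  simp only [id]
  ring

lemma continuousOn_cayley : ContinuousOn cayley (Set.Icc 0 1) := fun t ht =>
  (hasDerivAt_cayley (by linarith [ht.1])).continuousAt.continuousWithinAt

lemma one_sub_cayley_sq {t : ℝ} (ht : 0 < 1 + t) : 1 - cayley t ^ 2 = 4 * t / (1 + t) ^ 2 := by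
  rw [cayley]; field_simp; ring

lemma cayley_mem {t : ℝ} (ht : t ∈ Set.Ioo (0 : ℝ) 1) : cayley t ∈ Set.Ioo (0 : ℝ) 1 := by
  have h0 := ht.1
  have h1 := ht.2
  exact ⟨div_pos (by linarith) (by linarith), (div_lt_one (by linarith)).2 (by linarith)⟩

lemma measurable_cayley : Measurable cayley := by unfold cayley; fun_prop

lemma lintegral_cayley_pow_mul_log {K : ℕ} (hK : K ≠ 0) :
    ∫⁻ t in Set.Ioo (0 : ℝ) 1,
        ENNReal.ofReal (cayley t ^ (2 * K) * (-Real.log t / (1 - t ^ 2)))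
      = ENNReal.ofReal (h K / (2 * K)) := by
  have hK' : (K : ℝ) ≠ 0 := by exact_mod_cast hK
  have hgeom (t : ℝ) (ht : 0 < 1 + t) : 1 - cayley t ^ (2 * K)
      = (∑ j ∈ Finset.range K, (cayley t ^ 2) ^ j) * (4 * t / (1 + t) ^ 2) := by
    rw [← one_sub_cayley_sq ht, geom_sum_mul_neg, pow_mul]
  rw [lintegral_Ioo_of_hasDerivAt (F := fun t => (-Real.log t * (1 - cayley t ^ (2 * K))
    - 2 * ∑ j ∈ Finset.range K, cayley t ^ (2 * j + 1) / (2 * j + 1)) / (4 * K)) zero_le_one]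
  · have c0 : cayley 0 = 1 := by simp [cayley]
    have c1 : cayley 1 = 0 := by simp [cayley]
    simp only [c0, c1, one_pow, h]
    congr 1
    simp
    field_simp
    ring
  · have hc := continuousOn_cayley
    have hl := Real.continuous_mul_log.continuousOn (s := Set.Icc (0 : ℝ) 1)
    have h4 : ContinuousOn (fun t : ℝ => 4 / (1 + t) ^ 2) (Set.Icc 0 1) :=
      continuousOn_const.div (by fun_prop) fun t ht => by
        have := ht.1; positivity
    have h1 : ContinuousOn (fun t : ℝ => (-(t * Real.log t)
        * ((∑ j ∈ Finset.range K, (cayley t ^ 2) ^ j) * (4 / (1 + t) ^ 2))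
        - 2 * ∑ j ∈ Finset.range K, cayley t ^ (2 * j + 1) / (2 * j + 1)) / (4 * K))
        (Set.Icc 0 1) := by
      fun_prop
    refine h1.congr fun t ht => ?_
    simp only [hgeom t (by linarith [ht.1])]
    ring
  · intro t ht
    have h0 := ht.1
    have hp : 0 < 1 + t := by linarith
    have hm : 1 - t ≠ 0 := by linarith [ht.2]
    have hc := hasDerivAt_cayley hp
    have hs : HasDerivAt (fun t => ∑ j ∈ Finset.range K, cayley t ^ (2 * j + 1) / (2 * (j : ℝ) + 1))
        ((∑ j ∈ Finset.range K, (cayley t ^ 2) ^ j) * (-2 / (1 + t) ^ 2)) t := by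
      rw [Finset.sum_mul]
      refine HasDerivAt.fun_sum fun j _ => ?_
      convert! (hc.pow (2 * j + 1)).div_const (2 * (j : ℝ) + 1) using 1
      have : 2 * (j : ℝ) + 1 ≠ 0 := by positivity
      push_cast
      simp only [pow_mul]
      field_simp
    have h1 := (((Real.hasDerivAt_log h0.ne').neg.mul ((hc.pow (2 * K)).const_sub 1)).sub
      (hs.const_mul 2)).div_const (4 * (K : ℝ))
    convert! h1 using 1
    simp only [Pi.neg_apply, Pi.pow_apply]
    rw [hgeom t hp]
    obtain ⟨m, rfl⟩ := Nat.exists_eq_succ_of_ne_zero hK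
    have e1 : cayley t ^ (2 * (m + 1)) = cayley t ^ (2 * m + 1) * ((1 - t) / (1 + t)) := by
      rw [show 2 * (m + 1) = 2 * m + 1 + 1 by ring, pow_succ, cayley]
    have e2 : 2 * (m + 1) - 1 = 2 * m + 1 := by omega
    simp only [Nat.succ_eq_add_one] at *
    rw [e1, e2, show 1 - t ^ 2 = (1 - t) * (1 + t) by ring]
    push_cast at *
    field_simp
    ring
  · intro t ht
    have h1 := (cayley_mem ht).1
    have h2 := Real.log_nonpos ht.1.le ht.2.le
    refine mul_nonneg (by positivity) (div_nonneg (by linarith) ?_)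
    nlinarith [ht.1, ht.2]

lemma lintegral_cayley_pow {t : ℝ} (ht : t ∈ Set.Ioo (0 : ℝ) 1) {K : ℕ} (hK : K ≠ 0) :
    ∫⁻ u in Set.Ioo t 1, ENNReal.ofReal (4 / (1 - u ^ 2) * cayley u ^ (2 * K))
      = ENNReal.ofReal (cayley t ^ (2 * K) / K) := by
  have hK' : (K : ℝ) ≠ 0 := by exact_mod_cast hK
  rw [lintegral_Ioo_of_hasDerivAt (F := fun t => -(cayley t ^ (2 * K) / K)) ht.2.le]
  · have c1 : cayley 1 = 0 := by simp [cayley]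
    simp [c1, hK]
  · exact ((continuousOn_cayley.mono (Set.Icc_subset_Icc_left ht.1.le)).pow _).div_const _ |>.neg
  · intro u hu
    have hp : 0 < 1 + u := by linarith [ht.1, hu.1]
    have hm : 1 - u ≠ 0 := by linarith [hu.2]
    convert! (((hasDerivAt_cayley hp).pow (2 * K)).div_const (K : ℝ)).neg using 1
    obtain ⟨m, rfl⟩ := Nat.exists_eq_succ_of_ne_zero hK
    have e1 : cayley u ^ (2 * (m + 1)) = cayley u ^ (2 * m + 1) * ((1 - u) / (1 + u)) := by
      rw [show 2 * (m + 1) = 2 * m + 1 + 1 by ring, pow_succ, cayley]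
    have e2 : 2 * (m + 1) - 1 = 2 * m + 1 := by omega
    simp only [Nat.succ_eq_add_one] at *
    rw [e1, e2, show 1 - u ^ 2 = (1 - u) * (1 + u) by ring]
    push_cast at *
    field_simp
    ring
  · intro u hu
    have h1 := (cayley_mem ⟨ht.1.trans hu.1, hu.2⟩).1
    refine mul_nonneg (div_nonneg (by norm_num) ?_) (by positivity)
    nlinarith [ht.1, hu.1, hu.2]

lemma sum_one_div_odd_mul (n : ℕ) :
    ∑ k ∈ Finset.range (n + 1), 1 / (2 * (k : ℝ) + 1) * (1 / (2 * ((n - k : ℕ) : ℝ) + 1))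
      = h (n + 1) / (n + 1) := by
  have h1 : ∑ k ∈ Finset.range (n + 1), 1 / (2 * ((n - k : ℕ) : ℝ) + 1) = h (n + 1) :=
    Finset.sum_flip (fun k => 1 / (2 * (k : ℝ) + 1))
  have h2 : ∀ k ∈ Finset.range (n + 1),
      1 / (2 * (k : ℝ) + 1) * (1 / (2 * ((n - k : ℕ) : ℝ) + 1))
      = (1 / (2 * (k : ℝ) + 1) + 1 / (2 * ((n - k : ℕ) : ℝ) + 1)) / (2 * (n + 1)) := by
    intro k hk
    have hkn : k ≤ n := Nat.lt_succ_iff.1 (Finset.mem_range.1 hk)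
    have hn : (n : ℝ) = k + (n - k : ℕ) := by push_cast [hkn]; ring
    generalize ((n - k : ℕ) : ℝ) = r at *
    have h3 : 0 ≤ r := by
      have : (k : ℝ) ≤ n := by exact_mod_cast hkn
      linarith
    rw [hn]
    field_simp
    ring
  rw [Finset.sum_congr rfl h2, ← Finset.sum_div, Finset.sum_add_distrib, h1, ← h]
  field_simp
  ring

lemma hasSum_log_sq_div {u : ℝ} (hu : u ∈ Set.Ioo (0 : ℝ) 1) :
    HasSum (fun k : ℕ => (∑ i ∈ Finset.range (k + 1), h (i + 1) / ((i : ℝ) + 1))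
        * cayley u ^ (2 * (k + 1)))
      (Real.log u ^ 2 / 4 * (1 - cayley u ^ 2)⁻¹) := by
  obtain ⟨y0, y1⟩ := cayley_mem hu
  have hp : 0 < 1 + u := by linarith [hu.1]
  have hlog : Real.log (1 + cayley u) - Real.log (1 - cayley u) = -Real.log u := by
    rw [← Real.log_div (by linarith) (by linarith), ← Real.log_inv, cayley]
    have := hu.1.ne'
    rw [show 1 + (1 - u) / (1 + u) = 2 / (1 + u) by field_simp; ring,
      show 1 - (1 - u) / (1 + u) = 2 * u / (1 + u) by field_simp; ring]
    congr 1
    field_simp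
  generalize cayley u = y at *
  have hy2 : y ^ 2 < 1 := by nlinarith
  have hL : HasSum (fun k : ℕ => 1 / (2 * (k : ℝ) + 1) * y ^ (2 * k + 1)) (-Real.log u / 2) := by
    have := (Real.hasSum_log_sub_log_of_abs_lt_one (by rwa [abs_of_pos y0] : |y| < 1)).div_const 2
    rw [hlog] at this
    convert! this using 2
    ring
  have hLn : Summable fun k : ℕ => ‖1 / (2 * (k : ℝ) + 1) * y ^ (2 * k + 1)‖ := hL.summable.norm
  have hsq := hasSum_sum_range_mul_of_summable_norm hLn hLn
  rw [hL.tsum_eq] at hsq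
  have hcoef (n : ℕ) : ∑ k ∈ Finset.range (n + 1), 1 / (2 * (k : ℝ) + 1) * y ^ (2 * k + 1)
      * (1 / (2 * ((n - k : ℕ) : ℝ) + 1) * y ^ (2 * (n - k) + 1))
      = h (n + 1) / (n + 1) * y ^ (2 * (n + 1)) := by
    rw [← sum_one_div_odd_mul, Finset.sum_mul]
    refine Finset.sum_congr rfl fun k hk => ?_
    have hkn : k ≤ n := Nat.lt_succ_iff.1 (Finset.mem_range.1 hk)
    rw [show 2 * (n + 1) = (2 * k + 1) + (2 * (n - k) + 1) by omega, pow_add]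
    ring
  simp only [hcoef] at hsq
  have hg := hasSum_geometric_of_lt_one (sq_nonneg y) hy2
  have h3 := hasSum_sum_range_mul_of_summable_norm hsq.summable.norm hg.summable.norm
  rw [hsq.tsum_eq, hg.tsum_eq] at h3
  convert! h3 using 1
  · funext n
    rw [Finset.sum_mul]
    refine Finset.sum_congr rfl fun k hk => ?_
    have hkn : k ≤ n := Nat.lt_succ_iff.1 (Finset.mem_range.1 hk)
    rw [show 2 * (n + 1) = 2 * (k + 1) + 2 * (n - k) by omega, pow_add, ← pow_mul]
    ring
  · ring

lemma lintegral_neg_log_div {u : ℝ} (hu : u ∈ Set.Ioo (0 : ℝ) 1) :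
    ∫⁻ t in Set.Ioo 0 u, ENNReal.ofReal (-Real.log t / (1 - t ^ 2))
      = ∑' n : ℕ, ENNReal.ofReal (u ^ (2 * n + 1)
          * (-Real.log u / (2 * n + 1) + 1 / (2 * n + 1) ^ 2)) := by
  have h1 (n : ℕ) := lintegral_pow_mul_neg_log hu.1 hu.2 (2 * n)
  push_cast at h1
  simp only [← h1]
  rw [← MeasureTheory.lintegral_tsum fun n => by fun_prop]
  refine MeasureTheory.setLIntegral_congr_fun measurableSet_Ioo fun t ht => ?_
  have ht1 : t < 1 := ht.2.trans hu.2
  have hl := Real.log_nonpos ht.1.le ht1.le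
  refine (tsum_ofReal_of_hasSum
    (fun n => mul_nonneg (pow_nonneg ht.1.le _) (by linarith)) ?_).symm
  rw [div_eq_inv_mul]
  convert! (hasSum_geometric_of_lt_one (sq_nonneg t) (by nlinarith [ht.1])).mul_right
    (-Real.log t) using 2 with n
  rw [pow_mul]

lemma ofReal_one_add_div_one_sub_mul {u : ℝ} (hu : u ∈ Set.Ioo (0 : ℝ) 1) {q : ℝ} (hq : 0 ≤ q) :
    ENNReal.ofReal ((1 + u) / (1 - u) * q) = ENNReal.ofReal q
      + (∑' b : ℕ, ENNReal.ofReal (2 * (u ^ (2 * b + 1) * q))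
        + ∑' b : ℕ, ENNReal.ofReal (2 * (u ^ (2 * b + 2) * q))) := by
  have h0 := hu.1
  have h1 := hu.2
  have hu2 : u ^ 2 < 1 := by nlinarith
  have hd : 0 < 1 - u ^ 2 := by linarith
  have hs (r : ℕ) : HasSum (fun b : ℕ => 2 * (u ^ (2 * b + r) * q))
      (2 * (u ^ r * q) * (1 - u ^ 2)⁻¹) := by
    convert! (hasSum_geometric_of_lt_one (sq_nonneg u) hu2).mul_left (2 * (u ^ r * q)) using 2
      with b
    rw [← pow_mul]; ring
  rw [tsum_ofReal_of_hasSum (fun b => by positivity) (hs 1),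
    tsum_ofReal_of_hasSum (fun b => by positivity) (hs 2),
    ← ENNReal.ofReal_add (by positivity) (by positivity),
    ← ENNReal.ofReal_add (by positivity) (by positivity)]
  congr 1
  have h2 : 1 - u ≠ 0 := by linarith
  have h3 : (1 - u ^ 2)⁻¹ = 1 / ((1 - u) * (1 + u)) := by rw [one_div]; congr 1; ring
  rw [h3]
  field_simp
  ring

lemma h_nonneg (n : ℕ) : 0 ≤ h n := Finset.sum_nonneg fun i _ => by positivity

open MeasureTheory in
/-- The series as an integral, obtained by exchanging the order of integration. -/
lemma tsum_eq_lintegral :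
    ∑' k : ℕ, ENNReal.ofReal (h (k + 1) / ((k : ℝ) + 1) ^ 2
        * (∑ i ∈ Finset.range (k + 1), h (i + 1) / ((i : ℝ) + 1)))
      = ∫⁻ u in Set.Ioo (0 : ℝ) 1, ∑' n : ℕ, ENNReal.ofReal ((1 + u) / (1 - u)
          * (u ^ (2 * n) * (((-Real.log u) ^ 3 / (2 * n + 1) + (-Real.log u) ^ 2 / (2 * n + 1) ^ 2)
            / 2))) := by
  have hmc := measurable_cayley
  set A : ℕ → ℝ := fun k => ∑ i ∈ Finset.range (k + 1), h (i + 1) / ((i : ℝ) + 1)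
  have hA0 (k : ℕ) : 0 ≤ A k :=
    Finset.sum_nonneg fun i _ => div_nonneg (h_nonneg _) (by positivity)
  set φ : ℝ → ENNReal := fun t => ENNReal.ofReal (-Real.log t / (1 - t ^ 2)) with hφ
  have hφm : Measurable φ := by fun_prop
  set g : ℕ → ℝ → ENNReal := fun k u => ENNReal.ofReal (2 * A k) *
    ENNReal.ofReal (4 / (1 - u ^ 2) * cayley u ^ (2 * (k + 1))) with hg
  have hgm (k : ℕ) : Measurable (g k) := by fun_prop
  have hterm (k : ℕ) : ENNReal.ofReal (h (k + 1) / ((k : ℝ) + 1) ^ 2 * A k)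
      = ∫⁻ t in Set.Ioo (0 : ℝ) 1, φ t * ∫⁻ u in Set.Ioo t 1, g k u := by
    have h1 := lintegral_cayley_pow_mul_log k.succ_ne_zero
    have h2 : h (k + 1) / ((k : ℝ) + 1) ^ 2 * A k
        = 2 * A k / (k + 1) * (h (k + 1) / (2 * ((k + 1 : ℕ) : ℝ))) := by
      push_cast; field_simp
    have h3 := hA0 k
    rw [h2, ENNReal.ofReal_mul (by positivity), ← h1,
      ← lintegral_const_mul _ (by fun_prop)]
    refine setLIntegral_congr_fun measurableSet_Ioo fun t ht => ?_
    have hc := (cayley_mem ht).1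
    simp only [hg, hφ]
    have hl : 0 ≤ -Real.log t / (1 - t ^ 2) :=
      div_nonneg (by linarith [Real.log_nonpos ht.1.le ht.2.le]) (by nlinarith [ht.1, ht.2])
    rw [lintegral_const_mul _ (by fun_prop), lintegral_cayley_pow ht k.succ_ne_zero,
      ← ENNReal.ofReal_mul (by positivity), ← ENNReal.ofReal_mul (by positivity),
      ← ENNReal.ofReal_mul hl]
    congr 1
    push_cast
    ring
  have hΦm : Measurable fun u : ℝ => ∫⁻ t in Set.Ioo 0 u, φ t :=
    Monotone.measurable fun a b hab => lintegral_mono_set (Set.Ioo_subset_Ioo_right hab)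
  refine (tsum_congr fun k => (hterm k).trans (lintegral_Ioo_swap hφm (hgm k))).trans ?_
  refine (lintegral_tsum fun k => ((hgm k).mul hΦm).aemeasurable).symm.trans ?_
  simp only [Pi.mul_apply]
  simp only [ENNReal.tsum_mul_right]
  refine setLIntegral_congr_fun measurableSet_Ioo fun u hu => ?_
  have h0 := hu.1
  have h1 : 0 < 1 - u := by linarith [hu.2]
  have hl : 0 ≤ -Real.log u := by linarith [Real.log_nonpos hu.1.le hu.2.le]
  have hd : 0 < 1 - u ^ 2 := by nlinarith
  have hc := (cayley_mem hu).1
  have hsum : ∑' k, g k u = ENNReal.ofReal (Real.log u ^ 2 * (1 + u) / (2 * u * (1 - u))) := by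
    have h2 := (hasSum_log_sq_div hu).mul_left (2 * (4 / (1 - u ^ 2)))
    rw [one_sub_cayley_sq (by linarith)] at h2
    have h3 (k : ℕ) : g k u
        = ENNReal.ofReal (2 * (4 / (1 - u ^ 2)) * (A k * cayley u ^ (2 * (k + 1)))) := by
      simp only [hg]
      rw [← ENNReal.ofReal_mul (mul_nonneg two_pos.le (hA0 k))]
      congr 1
      ring
    simp only [h3]
    rw [tsum_ofReal_of_hasSum (fun k => ?_) h2]
    · congr 1
      rw [show 1 - u ^ 2 = (1 - u) * (1 + u) by ring]
      field_simp
      ring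
    · have := hA0 k
      positivity
  simp only [hsum, hφ]
  rw [lintegral_neg_log_div hu, ← ENNReal.tsum_mul_left]
  refine tsum_congr fun n => ?_
  rw [← ENNReal.ofReal_mul (by positivity)]
  congr 1
  field_simp
  ring

open MeasureTheory in
lemma tsum_eq_ofReal :
    ∑' k : ℕ, ENNReal.ofReal (h (k + 1) / ((k : ℝ) + 1) ^ 2
        * (∑ i ∈ Finset.range (k + 1), h (i + 1) / ((i : ℝ) + 1)))
      = ENNReal.ofReal (4 * stepSum 1 5 + 6 * (doubleSum 1 1 1 4 + doubleSum 1 2 1 4)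
      + 2 * (doubleSum 1 1 2 3 + doubleSum 1 2 2 3)) := by
  have hq (n : ℕ) {u : ℝ} (hu : u ∈ Set.Ioo (0 : ℝ) 1) : 0 ≤ u ^ (2 * n) *
      (((-Real.log u) ^ 3 / (2 * n + 1) + (-Real.log u) ^ 2 / (2 * n + 1) ^ 2) / 2) := by
    have h0 := hu.1
    have hl : 0 ≤ -Real.log u := by linarith [Real.log_nonpos hu.1.le hu.2.le]
    positivity
  have hint (n m : ℕ) := lintegral_pow_mul_log_cube_add_sq
    (by positivity : 0 < 2 * (n : ℝ) + 1) (2 * n + m)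
  have hfirst (n : ℕ) : ∫⁻ u in Set.Ioo (0 : ℝ) 1, ENNReal.ofReal (u ^ (2 * n) *
      (((-Real.log u) ^ 3 / (2 * n + 1) + (-Real.log u) ^ 2 / (2 * n + 1) ^ 2) / 2))
      = ENNReal.ofReal (4 * (1 / (2 * (n : ℝ) + 1) ^ 5)) := by
    have h1 := hint n 0
    rw [show 4 * (1 / (2 * (n : ℝ) + 1) ^ 5) = 1 / 2 *
      (6 * (1 / ((2 * (n : ℝ) + 1) ^ 1 * (((2 * n + 0 : ℕ) : ℝ) + 1) ^ 4))
      + 2 * (1 / ((2 * (n : ℝ) + 1) ^ 2 * (((2 * n + 0 : ℕ) : ℝ) + 1) ^ 3))) by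
        push_cast; rw [add_zero]; field_simp; ring,
      ENNReal.ofReal_mul (by norm_num), ← h1, ← lintegral_const_mul _ (by fun_prop)]
    refine lintegral_congr fun u => ?_
    rw [← ENNReal.ofReal_mul (by norm_num)]
    congr 1
    rw [add_zero]
    ring
  have hrest {β : ℝ} {r : ℕ} (hβ : β = r) (hβ1 : 1 ≤ β) :
      ∑' n : ℕ, ∑' b : ℕ, ∫⁻ u in Set.Ioo (0 : ℝ) 1, ENNReal.ofReal (2 * (u ^ (2 * b + r) *
        (u ^ (2 * n) *
        (((-Real.log u) ^ 3 / (2 * n + 1) + (-Real.log u) ^ 2 / (2 * n + 1) ^ 2) / 2))))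
      = ENNReal.ofReal (6 * doubleSum 1 β 1 4 + 2 * doubleSum 1 β 2 3) := by
    rw [← ENNReal.tsum_prod, ← tsum_ofReal_of_hasSum (fun x => ?_)
      (((hasSum_doubleSum le_rfl hβ1 le_rfl (by norm_num : 2 ≤ 4) (by norm_num)).mul_left 6).add
      ((hasSum_doubleSum le_rfl hβ1 (by norm_num : 1 ≤ 2) (by norm_num : 2 ≤ 3)
        (by norm_num)).mul_left 2))]
    · refine tsum_congr fun x => ?_
      have h1 := hint x.1 (2 * x.2 + r)
      convert! h1 using 1
      · refine lintegral_congr fun u => ?_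
        congr 1
        rw [pow_add u (2 * x.1)]
        ring
      · congr 1
        push_cast
        rw [hβ]
        ring
    · positivity
  have hs := stepSum_nonneg zero_le_one 5
  have hd1 := doubleSum_nonneg zero_le_one zero_le_one
  have hd2 := doubleSum_nonneg zero_le_one zero_le_two
  rw [tsum_eq_lintegral, lintegral_tsum fun n => by fun_prop]
  have hsplit (n : ℕ) : ∫⁻ u in Set.Ioo (0 : ℝ) 1, ENNReal.ofReal ((1 + u) / (1 - u)
        * (u ^ (2 * n) * (((-Real.log u) ^ 3 / (2 * n + 1) + (-Real.log u) ^ 2 / (2 * n + 1) ^ 2)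
            / 2))) = _ :=
    (setLIntegral_congr_fun measurableSet_Ioo
      fun u hu => ofReal_one_add_div_one_sub_mul hu (hq n hu)).trans <|
    (lintegral_add_left (by fun_prop) _).trans <| congrArg₂ (· + ·) (hfirst n) <|
    (lintegral_add_left (Measurable.tsum fun b => by fun_prop) _).trans <|
    congrArg₂ (· + ·) (lintegral_tsum fun b => by fun_prop) (lintegral_tsum fun b => by fun_prop)
  simp only [hsplit]
  rw [ENNReal.tsum_add, ENNReal.tsum_add, hrest (β := 1) (by norm_num) le_rfl,
    hrest (β := 2) (by norm_num) one_le_two,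
    tsum_ofReal_of_hasSum (fun n => by positivity)
      ((hasSum_stepSum le_rfl (by norm_num : 2 ≤ 5)).mul_left 4),
    ← ENNReal.ofReal_add, ← ENNReal.ofReal_add]
  · congr 1
    ring
  all_goals
    have := hd1 1 4
    have := hd1 2 3
    have := hd2 1 4
    have := hd2 2 3
    positivity

theorem stmt8 :
    HasSum (fun k : ℕ => h (k + 1) / ((k : ℝ) + 1) ^ 2
        * (∑ i ∈ Finset.range (k + 1), h (i + 1) / ((i : ℝ) + 1)))
      (-(31 / 32) * zeta 5 + (45 / 8) * Real.log 2 * zeta 4 + (7 / 8) * zeta 2 * zeta 3) := by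
  have h0 (k : ℕ) : 0 ≤ h (k + 1) / ((k : ℝ) + 1) ^ 2
      * (∑ i ∈ Finset.range (k + 1), h (i + 1) / ((i : ℝ) + 1)) :=
    mul_nonneg (div_nonneg (h_nonneg _) (by positivity))
      (Finset.sum_nonneg fun i _ => div_nonneg (h_nonneg _) (by positivity))
  have hval := tsum_eq_ofReal
  have hsum := ENNReal.summable_toReal (hval.trans_ne ENNReal.ofReal_ne_top)
  simp only [ENNReal.toReal_ofReal (h0 _)] at hsum
  rw [← ENNReal.ofReal_tsum_of_nonneg h0 hsum, ENNReal.ofReal_eq_ofReal_iff (tsum_nonneg h0)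
    ?_] at hval
  · rw [← doubleSum_evaluation, ← hval]
    exact hsum.hasSum
  · have hs := stepSum_nonneg zero_le_one 5
    have h1 := doubleSum_nonneg zero_le_one zero_le_one
    have h2 := doubleSum_nonneg zero_le_one zero_le_two
    have := h1 1 4
    have := h1 2 3
    have := h2 1 4
    have := h2 2 3
    positivity
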